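/- Let e ≥ 2 and r ≥ 2 be integers. Suppose c ≤ d are integers and t_1,…,t_l ∈ {c, c+1, …, d} satisfy |{j ∈ {1,…,l} : t_j ∈ 𝟙_r}| > |{c, c+1, …, d} ∩ 𝟙_r|. Then the wedge |t_1⟩∧…∧|t_l⟩ equals zero in the l-wedge space Λ^l_{e,r}. -/

import Mathlib

noncomputable section

/-- The field `ℚ(q)` of rational functions. -/
abbrev K : Type := RatFunc ℚ

/-- The element `q` of `ℚ(q)`. -/
def qK : K := RatFunc.X

/-- `a_{r'}(t)`: the unique element of `{1,…,e}` congruent to `t` modulo `e`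
(this does not depend on `r'`). -/
def aFun (e t : ℤ) : ℤ := (t - 1) % e + 1

/-- `b_{r'}(t)`: the unique element of `{1,…,r'}` such that
`t = a_{r'}(t) + e (b_{r'}(t) − 1) − e r' m` for some integer `m`. -/
def bFun (e r t : ℤ) : ℤ := (t - 1) % (e * r) / e + 1

/-- `m_{r'}(t)`: the unique integer with
`t = a_{r'}(t) + e (b_{r'}(t) − 1) − e r' m_{r'}(t)`. -/
def mFun (e r t : ℤ) : ℤ := (aFun e t + e * (bFun e r t - 1) - t) / (e * r)

/-- The free `ℚ(q)`-module on the set of `l`-tuples of integers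
(the basis element at `(t₁,…,t_l)` is the formal wedge `|t₁⟩∧…∧|t_l⟩`). -/
abbrev FW (l : ℕ) := (Fin l → ℤ) →₀ K

/-- The formal two-entry wedge `|x⟩∧|y⟩` in the free module on pairs. -/
def pairTerm (x y : ℤ) : (ℤ × ℤ) →₀ K := Finsupp.single (x, y) 1

/-- The sum `Σ_{m ≥ m0} coeff m · |u−γ−Nm⟩∧|t+γ+Nm⟩`, where `m` ranges only over those
values for which the displayed wedge is ordered (first entry strictly bigger).  Since
`N ≥ 2` and `γ ≥ 0` in all uses, all such `m` satisfy `m ≤ (u−t).toNat`, so the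
following finite sum captures all of them. -/
def pairSum (N t u γ : ℤ) (m0 : ℕ) (coeff : ℕ → K) : (ℤ × ℤ) →₀ K :=
  ∑ m ∈ Finset.Ico m0 ((u - t).toNat + 1),
    if t + γ + N * m < u - γ - N * m then coeff m • pairTerm (u - γ - N * m) (t + γ + N * m)
    else 0

/-- For `t ≤ u`, the right-hand side of the straightening relation for `|t⟩∧|u⟩`
in the wedge space with parameters `e, r`. -/
def pairRHS (e r t u : ℤ) : (ℤ × ℤ) →₀ K :=
  let N := e * r
  let α := (aFun e u - aFun e t) % N
  let β := (e * (bFun e r u - bFun e r t)) % N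
  if α = 0 ∧ β = 0 then -pairTerm u t
  else if β = 0 then
    -(qK⁻¹ • pairTerm u t) +
      (qK ^ (-2 : ℤ) - 1) •
        (pairSum N t u α 0 (fun m => qK ^ (-2 * (m : ℤ))) -
          pairSum N t u 0 1 (fun m => qK ^ (1 - 2 * (m : ℤ))))
  else if α = 0 then
    -(qK • pairTerm u t) +
      (qK ^ (2 : ℤ) - 1) •
        (pairSum N t u β 0 (fun m => qK ^ (2 * (m : ℤ))) -
          pairSum N t u 0 1 (fun m => qK ^ (2 * (m : ℤ) - 1)))
  else
    -pairTerm u t +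
      (qK - qK⁻¹) • pairSum N t u β 0
        (fun m => (qK ^ (2 * (m : ℤ) + 1) + qK ^ (-2 * (m : ℤ) - 1)) / (qK + qK⁻¹)) +
      (qK⁻¹ - qK) • pairSum N t u α 0
        (fun m => (qK ^ (2 * (m : ℤ) + 1) + qK ^ (-2 * (m : ℤ) - 1)) / (qK + qK⁻¹)) +
      (qK - qK⁻¹) • pairSum N t u (α + β) 0
        (fun m => (qK ^ (2 * (m : ℤ) + 2) - qK ^ (-2 * (m : ℤ) - 2)) / (qK + qK⁻¹)) +
      (qK⁻¹ - qK) • pairSum N t u 0 1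
        (fun m => (qK ^ (2 * (m : ℤ)) - qK ^ (-2 * (m : ℤ))) / (qK + qK⁻¹))

/-- Replace the entries of an `l`-tuple at positions `j` and `j+1` by `p.1` and `p.2`. -/
def updPair (l : ℕ) (ts : Fin l → ℤ) (j : ℕ) (p : ℤ × ℤ) : Fin l → ℤ :=
  fun i => if (i : ℕ) = j then p.1 else if (i : ℕ) = j + 1 then p.2 else ts i

/-- The set of straightening relators: for every `l`-tuple `ts` and every pair of
adjacent positions `j, j+1` with `ts j ≤ ts (j+1)`, the element
`|ts⟩ − (RHS of the straightening relation applied at positions j, j+1)`. -/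
def relSet (e r : ℤ) (l : ℕ) : Set (FW l) :=
  {x | ∃ (ts : Fin l → ℤ) (j j' : Fin l), (j' : ℕ) = (j : ℕ) + 1 ∧ ts j ≤ ts j' ∧
      x = Finsupp.single ts 1 -
        (pairRHS e r (ts j) (ts j')).sum fun p c => Finsupp.single (updPair l ts (j : ℕ) p) c}

/-- The `l`-wedge space `Λ^l_{e,r}`: the quotient of the free module on `l`-tuples by
the straightening relations. -/
abbrev WedgeSpace (e r : ℤ) (l : ℕ) := FW l ⧸ Submodule.span K (relSet e r l)

/-- The image of the wedge `|ts 0⟩∧…∧|ts (l−1)⟩` in the `l`-wedge space. -/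
def wedge (e r : ℤ) (l : ℕ) (ts : Fin l → ℤ) : WedgeSpace e r l :=
  Submodule.Quotient.mk (Finsupp.single ts 1)

/-- The pairs `p` that may occur when the wedge `|t⟩∧|u⟩` is straightened: `p` is ordered, has
entries in `[t, u]` with the same sum as `(t, u)`, and its entries have the same `b`-values as
`t` and `u`, up to order. -/
def straightenedPairs (e r t u : ℤ) : Set (ℤ × ℤ) :=
  {p | p.2 < p.1 ∧ t ≤ p.2 ∧ p.1 + p.2 = t + u ∧
    ((bFun e r p.1 = bFun e r u ∧ bFun e r p.2 = bFun e r t) ∨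
      (bFun e r p.1 = bFun e r t ∧ bFun e r p.2 = bFun e r u))}

lemma bFun_eq_of_eq {e r x A B k : ℤ} (hA : 0 ≤ A) (hAe : A < e) (hB : 1 ≤ B) (hBr : B ≤ r)
    (hx : x - 1 = A + e * (B - 1) + e * r * k) : bFun e r x = B := by
  have he : 0 < e := by linarith
  have h : (A + e * (B - 1)) % (e * r) = A + e * (B - 1) :=
    Int.emod_eq_of_lt (by nlinarith) (by nlinarith)
  rw [bFun, hx, Int.add_mul_emod_self_left, h, Int.add_mul_ediv_left _ _ he.ne',
    Int.ediv_eq_zero_of_lt hA hAe]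
  ring

lemma exists_eq_aFun_add_bFun (e r x : ℤ) :
    ∃ k, x - 1 = (aFun e x - 1) + e * (bFun e r x - 1) + e * r * k := by
  refine ⟨(x - 1) / (e * r), ?_⟩
  have h1 := Int.emod_add_mul_ediv (x - 1) (e * r)
  have h2 := Int.emod_add_mul_ediv ((x - 1) % (e * r)) e
  rw [Int.emod_emod_of_dvd _ (dvd_mul_right e r)] at h2
  simp only [aFun, bFun]
  linarith

lemma aFun_bounds {e : ℤ} (he : 0 < e) (x : ℤ) : 0 ≤ aFun e x - 1 ∧ aFun e x - 1 < e := by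
  simpa [aFun] using And.intro (Int.emod_nonneg (x - 1) he.ne') (Int.emod_lt_of_pos (x - 1) he)

lemma bFun_bounds {e r : ℤ} (he : 0 < e) (hr : 0 < r) (x : ℤ) :
    1 ≤ bFun e r x ∧ bFun e r x ≤ r := by
  have hN : 0 < e * r := mul_pos he hr
  have h0 := Int.ediv_nonneg (Int.emod_nonneg (x - 1) hN.ne') he.le
  have h1 := Int.ediv_lt_of_lt_mul he
    (show (x - 1) % (e * r) < r * e by rw [mul_comm r]; exact Int.emod_lt_of_pos _ hN)
  simp only [bFun]
  omega

/-- Changing `x` so that its residue modulo `e` becomes that of `y` and its `b`-value that of `z`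
yields an integer with the `b`-value of `z`. -/
lemma bFun_eq_of_residues {e r : ℤ} (he : 0 < e) (hr : 0 < r) (w y z k : ℤ)
    (hw : w - 1 = (aFun e y - 1) + e * (bFun e r z - 1) + e * r * k) :
    bFun e r w = bFun e r z :=
  bFun_eq_of_eq (aFun_bounds he y).1 (aFun_bounds he y).2 (bFun_bounds he hr z).1
    (bFun_bounds he hr z).2 hw

lemma pairSum_mem_supported {N t u γ : ℤ} {S : Set (ℤ × ℤ)} (m0 : ℕ) (coeff : ℕ → K)
    (h : ∀ m : ℕ, t + γ + N * m < u - γ - N * m → (u - γ - N * m, t + γ + N * m) ∈ S) :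
    pairSum N t u γ m0 coeff ∈ Finsupp.supported K K S := by
  refine Submodule.sum_mem _ fun m _ => ?_
  split_ifs with hm
  · exact Submodule.smul_mem _ _ (Finsupp.single_mem_supported K _ (h m hm))
  · exact Submodule.zero_mem _

lemma pairRHS_mem_supported {e r t u : ℤ} (he : 0 < e) (hr : 0 < r) (htu : t < u) :
    pairRHS e r t u ∈ Finsupp.supported K K (straightenedPairs e r t u) := by
  have hN : 0 < e * r := mul_pos he hr
  obtain ⟨kt, hkt⟩ := exists_eq_aFun_add_bFun e r t
  obtain ⟨ku, hku⟩ := exists_eq_aFun_add_bFun e r u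
  have hα0 := Int.emod_nonneg (aFun e u - aFun e t) hN.ne'
  have hβ0 := Int.emod_nonneg (e * (bFun e r u - bFun e r t)) hN.ne'
  have hα := Int.emod_add_mul_ediv (aFun e u - aFun e t) (e * r)
  have hβ := Int.emod_add_mul_ediv (e * (bFun e r u - bFun e r t)) (e * r)
  have hswap : pairTerm u t ∈ Finsupp.supported K K (straightenedPairs e r t u) :=
    Finsupp.single_mem_supported K _ ⟨htu, le_rfl, add_comm _ _, Or.inl ⟨rfl, rfl⟩⟩
  simp only [pairRHS]
  generalize (aFun e u - aFun e t) % (e * r) = α at *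
  generalize (e * (bFun e r u - bFun e r t)) % (e * r) = β at *
  generalize (aFun e u - aFun e t) / (e * r) = kα at *
  generalize (e * (bFun e r u - bFun e r t)) / (e * r) = kβ at *
  have hm0 : ∀ m : ℕ, 0 ≤ e * r * m := fun m => by positivity
  have hsumα : ∀ m0 coeff, pairSum (e * r) t u α m0 coeff ∈
      Finsupp.supported K K (straightenedPairs e r t u) := fun m0 coeff =>
    pairSum_mem_supported _ _ fun m hm =>
      ⟨hm, by have := hm0 m; dsimp only; linarith, by ring, Or.inl
        ⟨bFun_eq_of_residues he hr _ t u (ku + kα - m) (by linear_combination hku - hα),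
          bFun_eq_of_residues he hr _ u t (kt - kα + m) (by linear_combination hkt + hα)⟩⟩
  have hsumβ : ∀ m0 coeff, pairSum (e * r) t u β m0 coeff ∈
      Finsupp.supported K K (straightenedPairs e r t u) := fun m0 coeff =>
    pairSum_mem_supported _ _ fun m hm =>
      ⟨hm, by have := hm0 m; dsimp only; linarith, by ring, Or.inr
        ⟨bFun_eq_of_residues he hr _ u t (ku + kβ - m) (by linear_combination hku - hβ),
          bFun_eq_of_residues he hr _ t u (kt - kβ + m) (by linear_combination hkt + hβ)⟩⟩
  have hsumαβ : ∀ m0 coeff, pairSum (e * r) t u (α + β) m0 coeff ∈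
      Finsupp.supported K K (straightenedPairs e r t u) := fun m0 coeff =>
    pairSum_mem_supported _ _ fun m hm =>
      ⟨hm, by have := hm0 m; dsimp only; linarith, by ring, Or.inr
        ⟨bFun_eq_of_residues he hr _ t t (ku + kα + kβ - m)
            (by linear_combination hku - hα - hβ),
          bFun_eq_of_residues he hr _ u u (kt - kα - kβ + m)
            (by linear_combination hkt + hα + hβ)⟩⟩
  have hsum0 : ∀ m0 coeff, pairSum (e * r) t u 0 m0 coeff ∈
      Finsupp.supported K K (straightenedPairs e r t u) := fun m0 coeff =>
    pairSum_mem_supported _ _ fun m hm =>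
      ⟨hm, by have := hm0 m; dsimp only; linarith, by ring, Or.inl
        ⟨bFun_eq_of_residues he hr _ u u (ku - m) (by linear_combination hku),
          bFun_eq_of_residues he hr _ t t (kt + m) (by linear_combination hkt)⟩⟩
  split_ifs
  · exact Submodule.neg_mem _ hswap
  · exact Submodule.add_mem _ (Submodule.neg_mem _ (Submodule.smul_mem _ _ hswap))
      (Submodule.smul_mem _ _ (Submodule.sub_mem _ (hsumα _ _) (hsum0 _ _)))
  · exact Submodule.add_mem _ (Submodule.neg_mem _ (Submodule.smul_mem _ _ hswap))
      (Submodule.smul_mem _ _ (Submodule.sub_mem _ (hsumβ _ _) (hsum0 _ _)))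
  · exact Submodule.add_mem _ (Submodule.add_mem _ (Submodule.add_mem _ (Submodule.add_mem _
      (Submodule.neg_mem _ hswap) (Submodule.smul_mem _ _ (hsumβ _ _)))
      (Submodule.smul_mem _ _ (hsumα _ _))) (Submodule.smul_mem _ _ (hsumαβ _ _)))
      (Submodule.smul_mem _ _ (hsum0 _ _))

lemma wedge_eq_sum {e r : ℤ} {l : ℕ} (ts : Fin l → ℤ) {j j' : Fin l} (hj : (j' : ℕ) = j + 1)
    (hle : ts j ≤ ts j') :
    wedge e r l ts =
      (pairRHS e r (ts j) (ts j')).sum fun p c => c • wedge e r l (updPair l ts j p) := by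
  have h : Finsupp.single ts 1 - (pairRHS e r (ts j) (ts j')).sum
      (fun p c => Finsupp.single (updPair l ts j p) c) ∈ Submodule.span K (relSet e r l) :=
    Submodule.subset_span ⟨ts, j, j', hj, hle, rfl⟩
  rw [wedge, (Submodule.Quotient.eq _).2 h, ← Submodule.mkQ_apply, Finsupp.sum, map_sum,
    Finsupp.sum]
  refine Finset.sum_congr rfl fun p _ => ?_
  rw [wedge, ← Submodule.mkQ_apply, ← map_smul, Finsupp.smul_single_one]

lemma wedge_eq_zero_of_adjacent_eq {e r : ℤ} {l : ℕ} (ts : Fin l → ℤ) {j j' : Fin l}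
    (hj : (j' : ℕ) = j + 1) (heq : ts j = ts j') : wedge e r l ts = 0 := by
  have hupd : updPair l ts j (ts j', ts j') = ts := by
    funext i
    simp only [updPair]
    split_ifs with h1 h2
    · rw [← heq, Fin.ext h1]
    · rw [Fin.ext (h2.trans hj.symm)]
    · rfl
  have h := wedge_eq_sum (e := e) (r := r) ts hj heq.le
  rw [heq] at h
  simp only [pairRHS, sub_self, mul_zero, Int.zero_emod, and_self, if_true, pairTerm,
    ← Finsupp.single_neg] at h
  rw [Finsupp.sum_single_index (by exact zero_smul K _), hupd, neg_one_smul] at h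
  have h2 : (2 : K) • wedge e r l ts = 0 := by
    rw [two_smul]
    nth_rewrite 1 [h]
    exact neg_add_cancel _
  exact (smul_eq_zero.1 h2).resolve_left two_ne_zero

lemma sum_updPair {l : ℕ} (ts : Fin l → ℤ) {j j' : Fin l} (hj : (j' : ℕ) = j + 1) (p : ℤ × ℤ)
    (F : Fin l → ℤ → ℤ) :
    ∑ i, F i (updPair l ts j p i) =
      ∑ i, F i (ts i) + (F j p.1 - F j (ts j)) + (F j' p.2 - F j' (ts j')) := by
  have hne : j ≠ j' := fun h => by rw [h] at hj; omega
  have h : ∑ i, (F i (updPair l ts j p i) - F i (ts i)) =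
      (F j p.1 - F j (ts j)) + (F j' p.2 - F j' (ts j')) := by
    rw [Fintype.sum_eq_add j j' hne]
    · simp [updPair, hj]
    · rintro i ⟨h1, h2⟩
      have h1' : (i : ℕ) ≠ j := fun h => h1 (Fin.ext h)
      have h2' : (i : ℕ) ≠ j + 1 := fun h => h2 (Fin.ext (h.trans hj.symm))
      simp [updPair, h1', h2']
  rw [Finset.sum_sub_distrib] at h
  linarith

/-- A tuple with more entries in `𝟙_r` than `{c,…,d}` has is not strictly decreasing. -/
lemma exists_adjacent_le {e r c d : ℤ} {l : ℕ} {ts : Fin l → ℤ}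
    (hts : ∀ j, ts j ∈ Set.Icc c d)
    (hcard : ((Finset.Icc c d).filter fun x => bFun e r x = 1).card <
      (Finset.univ.filter fun j => bFun e r (ts j) = 1).card) :
    ∃ j j' : Fin l, (j' : ℕ) = j + 1 ∧ ts j ≤ ts j' := by
  by_contra! h
  have hanti : StrictAnti ts := by
    cases l with
    | zero => exact fun i => i.elim0
    | succ n => exact Fin.strictAnti_iff_succ_lt.2 fun i => h i.castSucc i.succ (by simp)
  refine hcard.not_ge (Finset.card_le_card_of_injOn ts ?_ hanti.injective.injOn)
  intro j hj
  simp only [Finset.coe_filter, Finset.mem_univ, true_and, Set.mem_ofPred_eq] at hj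
  simpa [hj] using hts j

/-- For `e ≥ 2`, `r ≥ 2`, `c ≤ d` and `t₁,…,t_l ∈ {c,…,d}`, if the number
of `j` with `t_j ∈ 𝟙_r` exceeds `|{c,…,d} ∩ 𝟙_r|` then `|t₁⟩∧…∧|t_l⟩ = 0` in `Λ^l_{e,r}`. -/
theorem wedge_eq_zero_of_many_ones (e r : ℤ) (he : 2 ≤ e) (hr : 2 ≤ r)
    (c d : ℤ) (hcd : c ≤ d) (l : ℕ) (ts : Fin l → ℤ) (hts : ∀ j, ts j ∈ Set.Icc c d)
    (hcard : ((Finset.Icc c d).filter fun x => bFun e r x = 1).card <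
      (Finset.univ.filter fun j => bFun e r (ts j) = 1).card) :
    wedge e r l ts = 0 := by
  have he0 : 0 < e := by linarith
  have hr0 : 0 < r := by linarith
  obtain ⟨n, hn⟩ : ∃ n : ℕ, ∑ i : Fin l, (i : ℤ) * (ts i - c) < n :=
    ⟨_, (Int.self_le_toNat _).trans_lt (by exact_mod_cast Nat.lt_succ_self _)⟩
  induction n generalizing ts with
  | zero =>
    refine absurd hn (not_lt.2 ?_)
    exact_mod_cast Finset.sum_nonneg fun i _ =>
      mul_nonneg (Int.natCast_nonneg _) (sub_nonneg.2 (hts i).1)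
  | succ n ih =>
    obtain ⟨j, j', hj, hle⟩ := exists_adjacent_le hts hcard
    rcases hle.eq_or_lt with heq | hlt
    · exact wedge_eq_zero_of_adjacent_eq ts hj heq
    rw [wedge_eq_sum ts hj hle]
    refine Finset.sum_eq_zero fun p hp => ?_
    obtain ⟨hp1, hp2, hp3, hp4⟩ :=
      (Finsupp.mem_supported K _).1 (pairRHS_mem_supported he0 hr0 hlt) hp
    beta_reduce
    rw [ih (updPair l ts j p), smul_zero]
    · intro i
      have h1 := hts j
      have h2 := hts j'
      have h3 := hts i
      simp only [updPair, Set.mem_Icc] at *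
      split_ifs <;> constructor <;> linarith
    · convert hcard using 1
      have h := sum_updPair ts hj p fun _ x => if bFun e r x = 1 then 1 else 0
      simp only [Finset.sum_boole] at h
      rcases hp4 with ⟨h1, h2⟩ | ⟨h1, h2⟩ <;> rw [h1, h2] at h <;>
        zify <;> linarith
    · have h := sum_updPair ts hj p fun i x => (i : ℤ) * (x - c)
      simp only [hj] at h
      push_cast at h hn
      have hj0 : (j : ℤ) * (p.1 + p.2) = j * (ts j + ts j') := by rw [hp3]
      nlinarith

end
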